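/- arXiv:1010.2098 — 3 statements merged into one kernel-verified Lean document; each statement's English description precedes it below -/
import Mathlib

section
/- If A : ℝⁿ → ℝⁿ is a smooth covector field satisfying A_μ(x) x^μ = 0 for all x, then there exists a smooth matrix-valued field Ω : ℝⁿ → Matrix n n ℝ with Ω antisymmetric at every point, such that A_μ(x) = Ω_{μν}(x) x^ν for all x. Explicitly one may take Ω_{μν}(x) = ∫₀¹ s (∂_ν A_μ − ∂_μ A_ν)(s x) ds. -/
open Finset

/-- Differentiation under the integral sign for a jointly `C^1` integrand on a compact interval. -/
theorem hasFDerivAt_intervalIntegral_of_contDiff {E F : Type*}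
    [NormedAddCommGroup E] [NormedSpace ℝ E] [ProperSpace E]
    [NormedAddCommGroup F] [NormedSpace ℝ F] {f : E × ℝ → F}
    (hf : ContDiff ℝ 1 f) (a b : ℝ) (x₀ : E) :
    HasFDerivAt (fun x => ∫ s in a..b, f (x, s))
      (∫ s in a..b, (fderiv ℝ f (x₀, s)).comp (ContinuousLinearMap.inl ℝ E ℝ)) x₀ := by
  have hf_cont : Continuous f := hf.continuous
  have hf'_cont : Continuous fun p : E × ℝ =>
      (fderiv ℝ f p).comp (ContinuousLinearMap.inl ℝ E ℝ) :=
    (hf.continuous_fderiv one_ne_zero).clm_comp continuous_const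
  obtain ⟨C, hC⟩ := ((isCompact_closedBall x₀ 1).prod (isCompact_uIcc (a := a) (b := b))
    ).exists_bound_of_continuousOn hf'_cont.continuousOn
  refine intervalIntegral.hasFDerivAt_integral_of_dominated_of_fderiv_le
    (F := fun x s => f (x, s)) (bound := fun _ => C)
    (F' := fun x s => (fderiv ℝ f (x, s)).comp (ContinuousLinearMap.inl ℝ E ℝ))
    (Metric.closedBall_mem_nhds x₀ one_pos) ?_ ?_ ?_ ?_ ?_ ?_
  · exact .of_forall fun x =>
      (hf_cont.comp (Continuous.prodMk_right x)).aestronglyMeasurable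
  · exact (hf_cont.comp (Continuous.prodMk_right x₀)).intervalIntegrable _ _
  · exact (hf'_cont.comp (Continuous.prodMk_right x₀)).aestronglyMeasurable
  · exact .of_forall fun s hs x hx => hC (x, s) ⟨hx, Set.uIoc_subset_uIcc hs⟩
  · exact intervalIntegrable_const
  · exact .of_forall fun s _ x _ =>
      (hf.differentiable one_ne_zero (x, s)).hasFDerivAt.comp x (hasFDerivAt_prodMk_left x s)

/-- The integral over a compact interval of a jointly `C^m` integrand is `C^m` in the parameter. -/
theorem contDiff_nat_intervalIntegral {E : Type*} {F : Type*}
    [NormedAddCommGroup E] [NormedSpace ℝ E] [FiniteDimensional ℝ E]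
    [NormedAddCommGroup F] [NormedSpace ℝ F] (m : ℕ) {f : E × ℝ → F}
    (hf : ContDiff ℝ m f) (a b : ℝ) :
    ContDiff ℝ m (fun x => ∫ s in a..b, f (x, s)) := by
  have : ProperSpace E := FiniteDimensional.proper ℝ E
  induction m generalizing f with
  | zero =>
    rw [Nat.cast_zero, contDiff_zero] at hf ⊢
    exact intervalIntegral.continuous_parametric_intervalIntegral_of_continuous'
      (f := fun x s => f (x, s)) hf a b
  | succ m ih =>
    push_cast at hf ⊢
    have hf₁ : ContDiff ℝ 1 f := hf.of_le le_add_self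
    have hderiv := hasFDerivAt_intervalIntegral_of_contDiff hf₁ a b
    refine contDiff_succ_iff_fderiv_apply.2
      ⟨fun x => (hderiv x).differentiableAt, by simp, fun v => ?_⟩
    have hf'_cont : Continuous fun p : E × ℝ =>
        (fderiv ℝ f p).comp (ContinuousLinearMap.inl ℝ E ℝ) :=
      (hf₁.continuous_fderiv one_ne_zero).clm_comp continuous_const
    have heq : (fun x => fderiv ℝ (fun x => ∫ s in a..b, f (x, s)) x v) =
        fun x => ∫ s in a..b, fderiv ℝ f (x, s) (v, 0) := by
      funext x
      have hint : IntervalIntegrable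
          (fun s => (fderiv ℝ f (x, s)).comp (ContinuousLinearMap.inl ℝ E ℝ))
          MeasureTheory.volume a b :=
        (hf'_cont.comp (Continuous.prodMk_right x)).intervalIntegrable _ _
      rw [(hderiv x).fderiv, ContinuousLinearMap.intervalIntegral_apply hint]
      simp
    rw [heq]
    exact ih (f := fun p => fderiv ℝ f p (v, 0))
      ((hf.fderiv_right le_rfl).clm_apply contDiff_const)

/-- The integral over a compact interval of a jointly smooth integrand is smooth in the
parameter. -/
theorem contDiff_infty_intervalIntegral {E F : Type*}
    [NormedAddCommGroup E] [NormedSpace ℝ E] [FiniteDimensional ℝ E]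
    [NormedAddCommGroup F] [NormedSpace ℝ F] {f : E × ℝ → F}
    (hf : ContDiff ℝ (⊤ : ℕ∞) f) (a b : ℝ) :
    ContDiff ℝ (⊤ : ℕ∞) (fun x => ∫ s in a..b, f (x, s)) :=
  contDiff_infty.2 fun m => contDiff_nat_intervalIntegral m (contDiff_infty.1 hf m) a b

/-- A differentiable covector field annihilating the radial direction satisfies
`A_μ(y) = -∑ ν, (∂_μ A_ν)(y) y^ν`. -/
theorem eq_neg_sum_fderiv_mul_of_sum_mul_eq_zero {ι : Type*} [Fintype ι] [DecidableEq ι]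
    {A : (ι → ℝ) → ι → ℝ} (hA : ∀ ν, Differentiable ℝ (fun x => A x ν))
    (h : ∀ x : ι → ℝ, ∑ ν, A x ν * x ν = 0) (y : ι → ℝ) (μ : ι) :
    A y μ = -∑ ν, fderiv ℝ (fun z => A z ν) y (Pi.single μ 1) * y ν := by
  have hsum : HasFDerivAt (fun x : ι → ℝ => ∑ ν, A x ν * x ν)
      (∑ ν, (A y ν • ContinuousLinearMap.proj (R := ℝ) (φ := fun _ : ι => ℝ) ν +
        y ν • fderiv ℝ (fun z => A z ν) y)) y :=
    HasFDerivAt.fun_sum fun ν _ => (hA ν y).hasFDerivAt.mul (hasFDerivAt_apply ν y)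
  simp only [h] at hsum
  have happ := congrArg (fun L => L (Pi.single μ 1)) (hsum.unique (hasFDerivAt_const 0 y))
  simp only [_root_.sum_apply, add_apply, smul_apply, ContinuousLinearMap.proj_apply,
    smul_eq_mul, zero_apply, sum_add_distrib, Pi.single_apply, mul_ite, mul_one, mul_zero,
    sum_ite_eq', mem_univ, if_true] at happ
  simp only [mul_comm (fderiv ℝ _ _ _)]
  linarith

/-- If `A` is a smooth covector field on ℝⁿ with `∑ μ, A_μ(x) x^μ = 0` for all `x`, then
there is a smooth, pointwise antisymmetric matrix field `Ω` with `A_μ(x) = ∑ ν, Ω_{μν}(x) x^ν`;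
explicitly one may take `Ω_{μν}(x) = ∫₀¹ s (∂_ν A_μ − ∂_μ A_ν)(s x) ds`. -/
theorem stmt1 (n : ℕ) (A : (Fin n → ℝ) → Fin n → ℝ)
    (hA : ∀ μ, ContDiff ℝ (⊤ : ℕ∞) (fun x => A x μ))
    (h : ∀ x : Fin n → ℝ, ∑ μ, A x μ * x μ = 0) :
    ∃ Ω : (Fin n → ℝ) → Matrix (Fin n) (Fin n) ℝ,
      (∀ μ ν, ContDiff ℝ (⊤ : ℕ∞) (fun x => Ω x μ ν)) ∧
      (∀ x μ ν, Ω x μ ν = - Ω x ν μ) ∧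
      (∀ x μ, A x μ = ∑ ν, Ω x μ ν * x ν) ∧
      (∀ x μ ν, Ω x μ ν = ∫ s in (0:ℝ)..1,
        s * (fderiv ℝ (fun y => A y μ) (s • x) (Pi.single ν 1)
             - fderiv ℝ (fun y => A y ν) (s • x) (Pi.single μ 1))) := by
  have hdiff : ∀ μ, Differentiable ℝ (fun x => A x μ) := fun μ => (hA μ).differentiable (by simp)
  have hpartial : ∀ μ ν, ContDiff ℝ (⊤ : ℕ∞) fun p : (Fin n → ℝ) × ℝ =>
      fderiv ℝ (fun y => A y μ) (p.2 • p.1) (Pi.single ν 1) := fun μ ν =>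
    (((hA μ).fderiv_right (m := (⊤ : ℕ∞)) (by simp)).comp
      (contDiff_snd.smul contDiff_fst)).clm_apply contDiff_const
  have hintegrand : ∀ μ ν, ContDiff ℝ (⊤ : ℕ∞) fun p : (Fin n → ℝ) × ℝ =>
      p.2 * (fderiv ℝ (fun y => A y μ) (p.2 • p.1) (Pi.single ν 1)
        - fderiv ℝ (fun y => A y ν) (p.2 • p.1) (Pi.single μ 1)) := fun μ ν =>
    contDiff_snd.mul ((hpartial μ ν).sub (hpartial ν μ))
  refine ⟨fun x μ ν => ∫ s in (0:ℝ)..1,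
        s * (fderiv ℝ (fun y => A y μ) (s • x) (Pi.single ν 1)
             - fderiv ℝ (fun y => A y ν) (s • x) (Pi.single μ 1)),
    fun μ ν => contDiff_infty_intervalIntegral (hintegrand μ ν) 0 1, fun x μ ν => ?_,
    fun x μ => ?_, fun _ _ _ => rfl⟩
  · rw [← intervalIntegral.integral_neg]
    exact intervalIntegral.integral_congr fun s _ => by ring
  · have hcont : ∀ ν, Continuous fun s : ℝ =>
        s * (fderiv ℝ (fun y => A y μ) (s • x) (Pi.single ν 1)
          - fderiv ℝ (fun y => A y ν) (s • x) (Pi.single μ 1)) * x ν := fun ν =>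
      ((hintegrand μ ν).continuous.comp (Continuous.prodMk_right x)).mul continuous_const
    have hderiv : ∀ s : ℝ, HasDerivAt (fun s : ℝ => s * A (s • x) μ)
        (∑ ν, s * (fderiv ℝ (fun y => A y μ) (s • x) (Pi.single ν 1)
          - fderiv ℝ (fun y => A y ν) (s • x) (Pi.single μ 1)) * x ν) s := by
      intro s
      have hray : HasDerivAt (fun s : ℝ => s • x) x s := by
        simpa using (hasDerivAt_id s).smul_const x
      have hmul := (hasDerivAt_id s).mul
        ((hdiff μ (s • x)).hasFDerivAt.comp_hasDerivAt s hray)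
      refine hmul.congr_deriv ?_
      have hexpand : fderiv ℝ (fun y => A y μ) (s • x) x =
          ∑ ν, fderiv ℝ (fun y => A y μ) (s • x) (Pi.single ν 1) * x ν := by
        generalize fderiv ℝ (fun y => A y μ) (s • x) = L
        conv_lhs => rw [pi_eq_sum_univ' x]
        simp [map_sum, mul_comm]
      have hradial := eq_neg_sum_fderiv_mul_of_sum_mul_eq_zero hdiff h (s • x) μ
      simp only [Function.comp_apply, id_eq, one_mul]
      rw [hexpand, hradial, mul_sum, ← sum_neg_distrib, ← sum_add_distrib]
      refine sum_congr rfl fun ν _ => ?_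
      simp only [Pi.smul_apply, smul_eq_mul]
      ring
    have hFTC := intervalIntegral.integral_eq_sub_of_hasDerivAt (a := 0) (b := 1)
      (fun s _ => hderiv s)
      ((continuous_finsetSum _ fun ν _ => hcont ν).intervalIntegrable _ _)
    rw [intervalIntegral.integral_finsetSum
      (fun ν _ => (hcont ν).intervalIntegrable _ _)] at hFTC
    simpa [intervalIntegral.integral_mul_const] using hFTC.symm
end

section
/- A smooth symmetric 2-tensor field h on ℝⁿ satisfies h_{μν}(x) x^μ = 0 for all x if and only if there exists a smooth 4-tensor field Ω_{αβγδ} satisfying the symmetries Ω_{αβγδ} = Ω_{γδαβ} = −Ω_{βαγδ}, such that h_{αγ}(x) = Ω_{αβγδ}(x) x^β x^δ for all x. -/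
open Finset

/-- The derivative under the integral sign, with respect to a parameter in a proper space, of a
continuously differentiable integrand. -/
lemma hasFDerivAt_integral_of_contDiff_one {H E : Type*} [NormedAddCommGroup H] [NormedSpace ℝ H]
    [ProperSpace H] [NormedAddCommGroup E] [NormedSpace ℝ E] {F : H × ℝ → E}
    (hF : ContDiff ℝ 1 F) (a b : ℝ) (x₀ : H) :
    HasFDerivAt (fun x => ∫ t in a..b, F (x, t))
      (∫ t in a..b, (fderiv ℝ F (x₀, t)).comp (ContinuousLinearMap.inl ℝ H ℝ)) x₀ := by
  have hF' : Continuous fun p : H × ℝ =>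
      (fderiv ℝ F p).comp (ContinuousLinearMap.inl ℝ H ℝ) :=
    (hF.continuous_fderiv one_ne_zero).clm_comp continuous_const
  obtain ⟨C, hC⟩ := ((isCompact_closedBall x₀ 1).prod
    (isCompact_uIcc (a := a) (b := b))).exists_bound_of_continuousOn hF'.continuousOn
  refine intervalIntegral.hasFDerivAt_integral_of_dominated_of_fderiv_le
    (F := fun x t => F (x, t))
    (F' := fun x t => (fderiv ℝ F (x, t)).comp (ContinuousLinearMap.inl ℝ H ℝ))
    (bound := fun _ => C) (Metric.closedBall_mem_nhds x₀ one_pos) ?_ ?_ ?_ ?_ ?_ ?_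
  · exact .of_forall fun x =>
      (hF.continuous.comp (Continuous.prodMk_right x)).aestronglyMeasurable
  · exact (hF.continuous.comp (Continuous.prodMk_right x₀)).intervalIntegrable _ _
  · exact (hF'.comp (Continuous.prodMk_right x₀)).aestronglyMeasurable
  · exact .of_forall fun t ht x hx => hC (x, t) ⟨hx, Set.uIoc_subset_uIcc ht⟩
  · exact intervalIntegrable_const
  · refine .of_forall fun t _ x _ => ?_
    exact ((hF.differentiable one_ne_zero (x, t)).hasFDerivAt).comp x
      (hasFDerivAt_prodMk_left x t)

lemma ContDiff.parametric_intervalIntegral_nat {H : Type u} [NormedAddCommGroup H]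
    [NormedSpace ℝ H] [ProperSpace H] (a b : ℝ) (k : ℕ) :
    ∀ {E : Type u} [NormedAddCommGroup E] [NormedSpace ℝ E] {F : H × ℝ → E},
      ContDiff ℝ k F → ContDiff ℝ k fun x => ∫ t in a..b, F (x, t) := by
  induction k with
  | zero =>
    intro E _ _ F hF
    rw [Nat.cast_zero, contDiff_zero] at hF ⊢
    exact intervalIntegral.continuous_parametric_intervalIntegral_of_continuous'
      (f := fun x t => F (x, t)) hF a b
  | succ k ih =>
    intro E _ _ F hF
    have h1 : ContDiff ℝ 1 F := hF.of_le (by exact_mod_cast Nat.le_add_left 1 k)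
    have hd := hasFDerivAt_integral_of_contDiff_one h1 a b
    rw [Nat.cast_add, Nat.cast_one] at hF ⊢
    refine contDiff_succ_iff_fderiv.2 ⟨fun x => (hd x).differentiableAt, by simp, ?_⟩
    rw [funext fun x => (hd x).fderiv]
    exact ih (F := fun p : H × ℝ => (fderiv ℝ F p).comp (ContinuousLinearMap.inl ℝ H ℝ))
      ((contDiff_succ_iff_fderiv.1 hF).2.2.clm_comp contDiff_const)

/-- An integral over an interval of a function that is jointly smooth in the parameter and the
integration variable depends smoothly on the parameter. -/
lemma ContDiff.parametric_intervalIntegral {H E : Type u} [NormedAddCommGroup H]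
    [NormedSpace ℝ H] [ProperSpace H] [NormedAddCommGroup E] [NormedSpace ℝ E] {F : H × ℝ → E}
    (hF : ContDiff ℝ (⊤ : ℕ∞) F) (a b : ℝ) :
    ContDiff ℝ (⊤ : ℕ∞) fun x => ∫ t in a..b, F (x, t) :=
  contDiff_infty.2 fun k => .parametric_intervalIntegral_nat a b k (contDiff_infty.1 hF k)

/-- The partial derivative of `g` in the direction of the `i`-th coordinate. -/
noncomputable def partialDeriv {n : ℕ} (i : Fin n) (g : (Fin n → ℝ) → ℝ) (x : Fin n → ℝ) : ℝ :=
  fderiv ℝ g x (Pi.single i 1)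

section partialDeriv

variable {n : ℕ} {g : (Fin n → ℝ) → ℝ}

lemma ContDiff.partialDeriv (hg : ContDiff ℝ (⊤ : ℕ∞) g) (i : Fin n) :
    ContDiff ℝ (⊤ : ℕ∞) (partialDeriv i g) :=
  (contDiff_infty_iff_fderiv.1 hg).2.clm_apply contDiff_const

lemma partialDeriv_comm (hg : ContDiff ℝ (⊤ : ℕ∞) g) (i j : Fin n) (x : Fin n → ℝ) :
    partialDeriv i (partialDeriv j g) x = partialDeriv j (partialDeriv i g) x := by
  have hd : DifferentiableAt ℝ (fderiv ℝ g) x :=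
    (contDiff_infty_iff_fderiv.1 (contDiff_infty_iff_fderiv.1 hg).2).1 x
  have key : ∀ i j, partialDeriv i (partialDeriv j g) x =
      fderiv ℝ (fderiv ℝ g) x (Pi.single i 1) (Pi.single j 1) := fun i j => by
    have := (hd.hasFDerivAt.clm_apply (hasFDerivAt_const (Pi.single j (1 : ℝ)) x)).fderiv
    unfold _root_.partialDeriv
    rw [this]
    simp
  rw [key, key]
  exact (hg.contDiffAt.isSymmSndFDerivAt (by
    rw [minSmoothness_of_isRCLikeNormedField]
    exact WithTop.coe_le_coe.2 (le_top : (2 : ℕ∞) ≤ ⊤))).eq _ _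

lemma fderiv_eq_sum_partialDeriv (x v : Fin n → ℝ) :
    fderiv ℝ g x v = ∑ i, partialDeriv i g x * v i := by
  conv_lhs => rw [pi_eq_sum_univ' v]
  simp [map_sum, partialDeriv, mul_comm]

/-- The derivative of a smooth function along the ray through `x`. -/
lemma hasDerivAt_comp_smul (hg : ContDiff ℝ (⊤ : ℕ∞) g) (x : Fin n → ℝ) (r : ℝ) :
    HasDerivAt (fun r : ℝ => g (r • x)) (∑ i, partialDeriv i g (r • x) * x i) r := by
  rw [← fderiv_eq_sum_partialDeriv]
  have h1 : HasDerivAt (fun r : ℝ => r • x) x r := by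
    simpa using (hasDerivAt_id r).smul_const x
  exact ((contDiff_infty_iff_fderiv.1 hg).1 (r • x)).hasFDerivAt.comp_hasDerivAt r h1

lemma partialDeriv_add {f : (Fin n → ℝ) → ℝ} (hf : ContDiff ℝ (⊤ : ℕ∞) f)
    (hg : ContDiff ℝ (⊤ : ℕ∞) g) (i : Fin n) (x : Fin n → ℝ) :
    partialDeriv i (fun x => f x + g x) x = partialDeriv i f x + partialDeriv i g x := by
  have := ((contDiff_infty_iff_fderiv.1 hf).1 x).hasFDerivAt.fun_add
    ((contDiff_infty_iff_fderiv.1 hg).1 x).hasFDerivAt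
  simp [partialDeriv, this.fderiv]

lemma partialDeriv_sum_mul_coord {f : Fin n → (Fin n → ℝ) → ℝ}
    (hf : ∀ j, ContDiff ℝ (⊤ : ℕ∞) (f j)) (i : Fin n) (x : Fin n → ℝ) :
    partialDeriv i (fun x => ∑ j, f j x * x j) x =
      f i x + ∑ j, partialDeriv i (f j) x * x j := by
  have h1 : ∀ j, HasFDerivAt (fun x : Fin n → ℝ => f j x * x j) _ x := fun j =>
    ((contDiff_infty_iff_fderiv.1 (hf j)).1 x).hasFDerivAt.mul
      (ContinuousLinearMap.proj (R := ℝ) (φ := fun _ : Fin n => ℝ) j).hasFDerivAt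
  have h2 := HasFDerivAt.fun_sum fun j (_ : j ∈ univ) => h1 j
  simp [partialDeriv, h2.fderiv, sum_add_distrib, Pi.single_apply, mul_comm]

end partialDeriv

section radialGauge

variable {n : ℕ} {h : (Fin n → ℝ) → Fin n → Fin n → ℝ}

/-- The second partial derivatives `∂_i ∂_j h_{μν}`. -/
noncomputable def hessianComp (h : (Fin n → ℝ) → Fin n → Fin n → ℝ) (i j μ ν : Fin n)
    (x : Fin n → ℝ) : ℝ :=
  partialDeriv i (partialDeriv j fun x => h x μ ν) x

/-- The linearised curvature of the tensor field `h`. -/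
noncomputable def linearCurvature (h : (Fin n → ℝ) → Fin n → Fin n → ℝ) (μ σ ν l : Fin n)
    (x : Fin n → ℝ) : ℝ :=
  hessianComp h l σ μ ν x - hessianComp h l μ σ ν x + hessianComp h ν μ σ l x -
    hessianComp h ν σ μ l x

lemma contDiff_linearCurvature (hsmooth : ∀ μ ν, ContDiff ℝ (⊤ : ℕ∞) (fun x => h x μ ν))
    (μ σ ν l : Fin n) : ContDiff ℝ (⊤ : ℕ∞) (linearCurvature h μ σ ν l) := by
  have key : ∀ i j μ ν, ContDiff ℝ (⊤ : ℕ∞) (hessianComp h i j μ ν) := fun i j μ ν =>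
    ((hsmooth μ ν).partialDeriv j).partialDeriv i
  exact (((key _ _ _ _).sub (key _ _ _ _)).add (key _ _ _ _)).sub (key _ _ _ _)

lemma linearCurvature_antisymm (μ σ ν l : Fin n) (x : Fin n → ℝ) :
    linearCurvature h μ σ ν l x = -linearCurvature h σ μ ν l x := by
  unfold linearCurvature
  ring

lemma hessianComp_comm (hsmooth : ∀ μ ν, ContDiff ℝ (⊤ : ℕ∞) (fun x => h x μ ν))
    (i j μ ν : Fin n) (x : Fin n → ℝ) : hessianComp h i j μ ν x = hessianComp h j i μ ν x :=
  partialDeriv_comm (hsmooth μ ν) i j x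

lemma hessianComp_symm (hsymm : ∀ x μ ν, h x μ ν = h x ν μ) (i j μ ν : Fin n)
    (x : Fin n → ℝ) : hessianComp h i j μ ν x = hessianComp h i j ν μ x := by
  simp only [hessianComp, hsymm _ μ ν]

lemma linearCurvature_pair_symm (hsmooth : ∀ μ ν, ContDiff ℝ (⊤ : ℕ∞) (fun x => h x μ ν))
    (hsymm : ∀ x μ ν, h x μ ν = h x ν μ) (μ σ ν l : Fin n) (x : Fin n → ℝ) :
    linearCurvature h μ σ ν l x = linearCurvature h ν l μ σ x := by
  unfold linearCurvature
  rw [hessianComp_comm hsmooth l σ, hessianComp_symm hsymm σ l μ ν,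
    hessianComp_comm hsmooth l μ, hessianComp_symm hsymm μ l σ ν,
    hessianComp_comm hsmooth ν μ, hessianComp_symm hsymm μ ν σ l,
    hessianComp_comm hsmooth ν σ, hessianComp_symm hsymm σ ν μ l]
  ring

lemma add_sum_partialDeriv_eq_zero (hsmooth : ∀ μ ν, ContDiff ℝ (⊤ : ℕ∞) (fun x => h x μ ν))
    (hrad : ∀ x : Fin n → ℝ, ∀ ν, ∑ μ, h x μ ν * x μ = 0) (x : Fin n → ℝ) (σ ν : Fin n) :
    h x σ ν + ∑ μ, partialDeriv σ (fun x => h x μ ν) x * x μ = 0 := by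
  have := partialDeriv_sum_mul_coord (fun μ => hsmooth μ ν) σ x
  rw [← this, funext fun x => hrad x ν]
  simp [partialDeriv]

lemma add_sum_hessianComp_eq_zero (hsmooth : ∀ μ ν, ContDiff ℝ (⊤ : ℕ∞) (fun x => h x μ ν))
    (hrad : ∀ x : Fin n → ℝ, ∀ ν, ∑ μ, h x μ ν * x μ = 0) (x : Fin n → ℝ) (l σ ν : Fin n) :
    partialDeriv l (fun x => h x σ ν) x + (partialDeriv σ (fun x => h x l ν) x +
      ∑ μ, hessianComp h l σ μ ν x * x μ) = 0 := by
  have hpd : ∀ μ, ContDiff ℝ (⊤ : ℕ∞) (partialDeriv σ fun x => h x μ ν) := fun μ =>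
    (hsmooth μ ν).partialDeriv σ
  have h1 := partialDeriv_sum_mul_coord hpd l x
  have h2 := partialDeriv_add (hsmooth σ ν)
    (g := fun x => ∑ μ, partialDeriv σ (fun x => h x μ ν) x * x μ)
    (ContDiff.sum fun μ _ => (hpd μ).mul (contDiff_apply ℝ ℝ μ)) l x
  simp only [hessianComp]
  rw [← h1, ← h2, funext fun x => add_sum_partialDeriv_eq_zero hsmooth hrad x σ ν]
  simp [partialDeriv]

/-- The contraction of the linearised curvature of a radially transverse field with the position
vector is `E (E + 1) h`, where `E` is the Euler vector field. -/
lemma sum_linearCurvature (hsmooth : ∀ μ ν, ContDiff ℝ (⊤ : ℕ∞) (fun x => h x μ ν))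
    (hsymm : ∀ x μ ν, h x μ ν = h x ν μ)
    (hrad : ∀ x : Fin n → ℝ, ∀ ν, ∑ μ, h x μ ν * x μ = 0) (y : Fin n → ℝ) (μ ν : Fin n) :
    ∑ σ, ∑ l, linearCurvature h μ σ ν l y * y σ * y l =
      ∑ σ, (∑ l, hessianComp h l σ μ ν y * y l) * y σ +
        2 * ∑ l, partialDeriv l (fun x => h x μ ν) y * y l := by
  have hB : ∀ i a b, partialDeriv i (fun x => h x a b) y = partialDeriv i (fun x => h x b a) y :=
    fun i a b => by simp only [hsymm _ a b]
  have F1 : ∀ σ ν, ∑ l, partialDeriv σ (fun x => h x l ν) y * y l = -h y σ ν := fun σ ν => by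
    linarith [add_sum_partialDeriv_eq_zero hsmooth hrad y σ ν]
  have F2 : ∀ l σ ν, ∑ m, hessianComp h l σ m ν y * y m =
      -(partialDeriv l (fun x => h x σ ν) y + partialDeriv σ (fun x => h x l ν) y) :=
    fun l σ ν => by linarith [add_sum_hessianComp_eq_zero hsmooth hrad y l σ ν]
  have T2 : ∑ σ, ∑ l, hessianComp h l μ σ ν y * y σ * y l =
      -∑ l, partialDeriv l (fun x => h x μ ν) y * y l + h y μ ν := by
    rw [sum_comm]
    simp_rw [← sum_mul, F2, neg_mul, add_mul, sum_neg_distrib, sum_add_distrib, F1]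
    ring
  have T3 : ∑ σ, ∑ l, hessianComp h ν μ σ l y * y σ * y l = 2 * h y μ ν := by
    rw [sum_comm]
    simp_rw [← sum_mul, F2, neg_mul, add_mul, sum_neg_distrib, sum_add_distrib, hB _ μ, hB _ ν,
      F1, hsymm y ν μ]
    ring
  have T4 : ∑ σ, ∑ l, hessianComp h ν σ μ l y * y σ * y l =
      h y μ ν - ∑ l, partialDeriv l (fun x => h x μ ν) y * y l := by
    have hcomm : ∑ σ, ∑ l, hessianComp h ν σ μ l y * y σ * y l =
        ∑ σ, (∑ l, hessianComp h ν σ l μ y * y l) * y σ := by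
      simp_rw [sum_mul]
      refine sum_congr rfl fun σ _ => sum_congr rfl fun l _ => ?_
      rw [hessianComp_symm hsymm ν σ μ l]
      ring
    rw [hcomm]
    simp_rw [F2, neg_mul, add_mul,
      sum_neg_distrib, sum_add_distrib, F1, hB _ ν μ, hsymm y ν μ]
    ring
  have T1 : ∑ σ, ∑ l, hessianComp h l σ μ ν y * y σ * y l =
      ∑ σ, (∑ l, hessianComp h l σ μ ν y * y l) * y σ := by
    simp_rw [sum_mul]
    exact sum_congr rfl fun _ _ => sum_congr rfl fun _ _ => by ring
  simp only [linearCurvature, sub_mul, add_mul, sum_sub_distrib, sum_add_distrib]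
  rw [T1, T2, T3, T4]
  ring

/-- The radial homotopy of the linearised curvature; integrating out one of the two radial
variables leaves the weight `r (1 - r)`. -/
noncomputable def radialPotential (h : (Fin n → ℝ) → Fin n → Fin n → ℝ) (x : Fin n → ℝ)
    (μ σ ν l : Fin n) : ℝ :=
  ∫ r in (0 : ℝ)..1, r * (1 - r) * linearCurvature h μ σ ν l (r • x)

lemma contDiff_radialPotential (hsmooth : ∀ μ ν, ContDiff ℝ (⊤ : ℕ∞) (fun x => h x μ ν))
    (μ σ ν l : Fin n) : ContDiff ℝ (⊤ : ℕ∞) fun x => radialPotential h x μ σ ν l := by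
  refine ContDiff.parametric_intervalIntegral (F := fun p : (Fin n → ℝ) × ℝ =>
    p.2 * (1 - p.2) * linearCurvature h μ σ ν l (p.2 • p.1)) ?_ 0 1
  exact (contDiff_snd.mul (contDiff_const.sub contDiff_snd)).mul
    ((contDiff_linearCurvature hsmooth μ σ ν l).comp (contDiff_snd.smul contDiff_fst))

lemma eq_sum_radialPotential (hsmooth : ∀ μ ν, ContDiff ℝ (⊤ : ℕ∞) (fun x => h x μ ν))
    (hsymm : ∀ x μ ν, h x μ ν = h x ν μ)
    (hrad : ∀ x : Fin n → ℝ, ∀ ν, ∑ μ, h x μ ν * x μ = 0) (x : Fin n → ℝ) (μ ν : Fin n) :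
    h x μ ν = ∑ σ, ∑ l, radialPotential h x μ σ ν l * x σ * x l := by
  have hcont : ∀ σ l, Continuous fun r : ℝ =>
      r * (1 - r) * linearCurvature h μ σ ν l (r • x) := fun σ l => by
    have := (contDiff_linearCurvature hsmooth μ σ ν l).continuous
    fun_prop
  have hcont₁ : ∀ σ l, Continuous fun r : ℝ =>
      r * (1 - r) * linearCurvature h μ σ ν l (r • x) * x σ * x l := fun σ l =>
    ((hcont σ l).mul continuous_const).mul continuous_const
  have hcont₂ : ∀ σ, Continuous fun r : ℝ =>
      ∑ l, r * (1 - r) * linearCurvature h μ σ ν l (r • x) * x σ * x l := fun σ =>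
    continuous_finsetSum _ fun l _ => hcont₁ σ l
  have hsum : ∑ σ, ∑ l, radialPotential h x μ σ ν l * x σ * x l =
      ∫ r in (0 : ℝ)..1, ∑ σ, ∑ l,
        r * (1 - r) * linearCurvature h μ σ ν l (r • x) * x σ * x l := by
    rw [intervalIntegral.integral_finsetSum fun σ _ =>
      (hcont₂ σ).intervalIntegrable _ _]
    refine sum_congr rfl fun σ _ => ?_
    rw [intervalIntegral.integral_finsetSum fun l _ =>
      (hcont₁ σ l).intervalIntegrable _ _]
    refine sum_congr rfl fun l _ => ?_
    simp only [intervalIntegral.integral_mul_const, radialPotential]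
  have hf : ∀ r : ℝ, HasDerivAt (fun r : ℝ => h (r • x) μ ν)
      (∑ i, partialDeriv i (fun x => h x μ ν) (r • x) * x i) r :=
    hasDerivAt_comp_smul (hsmooth μ ν) x
  have hf' : ∀ r : ℝ, HasDerivAt
      (fun r : ℝ => ∑ i, partialDeriv i (fun x => h x μ ν) (r • x) * x i)
      (∑ i, (∑ j, hessianComp h j i μ ν (r • x) * x j) * x i) r := fun r =>
    HasDerivAt.fun_sum fun i _ =>
      (hasDerivAt_comp_smul ((hsmooth μ ν).partialDeriv i) x r).mul_const (x i)
  have hG : ∀ r : ℝ, HasDerivAt (fun r : ℝ => h (r • x) μ ν + r * (1 - r) *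
      ∑ i, partialDeriv i (fun x => h x μ ν) (r • x) * x i) _ r := fun r =>
    (hf r).fun_add ((((hasDerivAt_id r).fun_mul ((hasDerivAt_id r).const_sub 1))).fun_mul (hf' r))
  have hzero : h 0 μ ν = 0 := by
    simpa using add_sum_partialDeriv_eq_zero hsmooth hrad 0 μ ν
  rw [hsum, intervalIntegral.integral_eq_sub_of_hasDerivAt_of_le zero_le_one
    (fun r _ => (hG r).continuousAt.continuousWithinAt) (fun r hr => ?_)
    ((continuous_finsetSum _ fun σ _ => hcont₂ σ).intervalIntegrable _ _)]
  · simp [hzero]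
  · have hr0 : r ≠ 0 := hr.1.ne'
    have key := sum_linearCurvature hsmooth hsymm hrad (r • x) μ ν
    simp only [Pi.smul_apply, smul_eq_mul] at key
    have e1 : ∑ σ, ∑ l, linearCurvature h μ σ ν l (r • x) * (r * x σ) * (r * x l) =
        r ^ 2 * ∑ σ, ∑ l, linearCurvature h μ σ ν l (r • x) * x σ * x l := by
      simp_rw [mul_sum]
      exact sum_congr rfl fun _ _ => sum_congr rfl fun _ _ => by ring
    have e2 : ∑ σ, (∑ l, hessianComp h l σ μ ν (r • x) * (r * x l)) * (r * x σ) =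
        r ^ 2 * ∑ σ, (∑ l, hessianComp h l σ μ ν (r • x) * x l) * x σ := by
      simp_rw [sum_mul, mul_sum]
      exact sum_congr rfl fun _ _ => sum_congr rfl fun _ _ => by ring
    have e3 : ∑ l, partialDeriv l (fun x => h x μ ν) (r • x) * (r * x l) =
        r * ∑ l, partialDeriv l (fun x => h x μ ν) (r • x) * x l := by
      simp_rw [mul_sum]
      exact sum_congr rfl fun _ _ => by ring
    have e4 : ∑ σ, ∑ l, r * (1 - r) * linearCurvature h μ σ ν l (r • x) * x σ * x l =
        r * (1 - r) * ∑ σ, ∑ l, linearCurvature h μ σ ν l (r • x) * x σ * x l := by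
      simp_rw [mul_sum]
      exact sum_congr rfl fun _ _ => sum_congr rfl fun _ _ => by ring
    rw [e1, e2, e3] at key
    rw [e4]
    refine (hG r).congr_deriv ?_
    simp only [id_eq]
    apply mul_left_cancel₀ hr0
    linear_combination (r - 1) * key

end radialGauge

/-- The full contraction in three slots of a tensor antisymmetric in its first two indices
vanishes. -/
lemma sum_mul_eq_zero_of_antisymm {n : ℕ} {ω : Fin n → Fin n → Fin n → ℝ}
    (hω : ∀ α β δ, ω α β δ = -ω β α δ) (x : Fin n → ℝ) :
    ∑ α, (∑ β, ∑ δ, ω α β δ * x β * x δ) * x α = 0 := by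
  have : ∑ α, (∑ β, ∑ δ, ω α β δ * x β * x δ) * x α =
      -∑ α, (∑ β, ∑ δ, ω α β δ * x β * x δ) * x α := by
    simp_rw [sum_mul]
    conv_lhs => rw [sum_comm]
    simp_rw [← sum_neg_distrib]
    refine sum_congr rfl fun α _ => sum_congr rfl fun β _ => sum_congr rfl fun δ _ => ?_
    rw [hω]
    ring
  linarith

/-- A smooth symmetric 2-tensor field `h` on ℝⁿ satisfies `h_{μν}(x) x^μ = 0` for all `x`
iff there is a smooth 4-tensor field `Ω` with the symmetries `Ω_{αβγδ} = Ω_{γδαβ} = −Ω_{βαγδ}`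
such that `h_{αγ}(x) = ∑ β δ, Ω_{αβγδ}(x) x^β x^δ`. -/
theorem stmt2 (n : ℕ) (h : (Fin n → ℝ) → Fin n → Fin n → ℝ)
    (hsmooth : ∀ μ ν, ContDiff ℝ (⊤ : ℕ∞) (fun x => h x μ ν))
    (hsymm : ∀ x μ ν, h x μ ν = h x ν μ) :
    (∀ x : Fin n → ℝ, ∀ ν, ∑ μ, h x μ ν * x μ = 0) ↔
    ∃ Ω : (Fin n → ℝ) → Fin n → Fin n → Fin n → Fin n → ℝ,
      (∀ α β γ δ, ContDiff ℝ (⊤ : ℕ∞) (fun x => Ω x α β γ δ)) ∧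
      (∀ x α β γ δ, Ω x α β γ δ = Ω x γ δ α β) ∧
      (∀ x α β γ δ, Ω x α β γ δ = - Ω x β α γ δ) ∧
      (∀ x α γ, h x α γ = ∑ β, ∑ δ, Ω x α β γ δ * x β * x δ) := by
  constructor
  · intro hrad
    refine ⟨radialPotential h, contDiff_radialPotential hsmooth, fun x α β γ δ => ?_,
      fun x α β γ δ => ?_, eq_sum_radialPotential hsmooth hsymm hrad⟩
    · simp only [radialPotential, linearCurvature_pair_symm hsmooth hsymm α β γ δ]
    · simp only [radialPotential, linearCurvature_antisymm α β γ δ, mul_neg,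
        intervalIntegral.integral_neg]
  · rintro ⟨Ω, -, -, hanti, hΩ⟩ x ν
    simp_rw [hΩ]
    exact sum_mul_eq_zero_of_antisymm (fun α β δ => hanti x α β ν δ) x
end

section
/- A function φ defined on the light cone C_O = {w ∈ ℝ^{n+1} : w⁰ = |⃗w|} can be extended to a C^k (respectively smooth) function on ℝ^{n+1} if and only if φ can be written as φ(⃗w) = φ̂(⃗w) + |⃗w| φ̌(⃗w) where φ̂ and φ̌ are C^k (respectively smooth) functions of ⃗w ∈ ℝⁿ. -/
open Finset

/-- Euclidean radius `r = |⃗w|`. -/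
noncomputable def rad {n : ℕ} (v : Fin n → ℝ) : ℝ := Real.sqrt (∑ i, v i ^ 2)

open scoped ContDiff Topology
open Asymptotics Filter

section ParametricIntegral

variable {V : Type*} [NormedAddCommGroup V] [NormedSpace ℝ V] [FiniteDimensional ℝ V]

theorem hasFDerivAt_intervalIntegral_of_contDiff_s10 {F : V × ℝ → ℝ} (hF : ContDiff ℝ 1 F) (x : V) :
    HasFDerivAt (fun x => ∫ t in (0 : ℝ)..1, F (x, t))
      (∫ t in (0 : ℝ)..1, (fderiv ℝ F (x, t)).comp (ContinuousLinearMap.inl ℝ V ℝ)) x := by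
  have hF' : Continuous fun p : V × ℝ => (fderiv ℝ F p).comp (ContinuousLinearMap.inl ℝ V ℝ) :=
    (hF.continuous_fderiv one_ne_zero).clm_comp continuous_const
  have hline : ∀ z : V, Continuous fun t : ℝ => (z, t) := fun z => by fun_prop
  obtain ⟨C, hC⟩ := ((isCompact_closedBall x 1).prod (isCompact_Icc (a := (0 : ℝ)) (b := 1)))
    |>.exists_bound_of_continuousOn hF'.continuousOn
  refine intervalIntegral.hasFDerivAt_integral_of_dominated_of_fderiv_le
    (F := fun x t => F (x, t))
    (F' := fun x t => (fderiv ℝ F (x, t)).comp (ContinuousLinearMap.inl ℝ V ℝ))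
    (bound := fun _ => C) (Metric.closedBall_mem_nhds x one_pos) ?_ ?_ ?_ ?_ ?_ ?_
  · exact Eventually.of_forall fun z => (hF.continuous.comp (hline z)).aestronglyMeasurable
  · exact (hF.continuous.comp (hline x)).intervalIntegrable _ _
  · exact (hF'.comp (hline x)).aestronglyMeasurable
  · refine Eventually.of_forall fun t ht z hz => hC (z, t) ⟨hz, ?_⟩
    rw [Set.uIoc_of_le zero_le_one] at ht
    exact ⟨ht.1.le, ht.2⟩
  · exact intervalIntegrable_const
  · refine Eventually.of_forall fun t _ z _ => ?_
    exact ((hF.differentiable one_ne_zero) (z, t)).hasFDerivAt.comp z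
      (hasFDerivAt_prodMk_left z t)

theorem ContDiff.intervalIntegral_snd {F : V × ℝ → ℝ} (hF : ContDiff ℝ ∞ F) :
    ContDiff ℝ ∞ (fun x => ∫ t in (0 : ℝ)..1, F (x, t)) := by
  refine contDiff_infty.2 fun m => ?_
  induction m generalizing F with
  | zero =>
    exact contDiff_zero.2 (intervalIntegral.continuous_parametric_intervalIntegral_of_continuous'
      (f := fun x t => F (x, t)) hF.continuous 0 1)
  | succ m ih =>
    have h1 : ContDiff ℝ 1 F := hF.of_le (by exact_mod_cast le_top)
    push_cast
    refine contDiff_succ_iff_fderiv_apply.2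
      ⟨fun x => (hasFDerivAt_intervalIntegral_of_contDiff_s10 h1 x).differentiableAt, by simp, ?_⟩
    intro y
    have hy : ContDiff ℝ ∞ fun p : V × ℝ => fderiv ℝ F p (y, 0) :=
      (hF.fderiv_right (m := ∞) (by simp)).clm_apply contDiff_const
    convert! ih hy using 2 with x
    rw [(hasFDerivAt_intervalIntegral_of_contDiff_s10 h1 x).fderiv,
      ContinuousLinearMap.intervalIntegral_apply]
    · simp
    · refine Continuous.intervalIntegrable ?_ _ _
      exact ((h1.continuous_fderiv one_ne_zero).comp (by fun_prop)).clm_comp continuous_const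

end ParametricIntegral

/-- Hadamard's lemma for functions that are odd in the first variable. -/
theorem exists_even_eq_mul_of_odd {E : Type*} [NormedAddCommGroup E] [NormedSpace ℝ E]
    [FiniteDimensional ℝ E] {F : ℝ × E → ℝ} (hF : ContDiff ℝ ∞ F)
    (hodd : ∀ t w, F (-t, w) = -F (t, w)) :
    ∃ H : ℝ × E → ℝ, ContDiff ℝ ∞ H ∧ (∀ t w, H (-t, w) = H (t, w)) ∧
      ∀ t w, F (t, w) = t * H (t, w) := by
  have hF0 : ∀ w, F (0, w) = 0 := fun w => by
    have := hodd 0 w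
    rw [neg_zero] at this
    linarith
  have hG : ContDiff ℝ ∞ fun q : (ℝ × E) × ℝ => fderiv ℝ F (q.2 * q.1.1, q.1.2) (1, 0) :=
    ((hF.fderiv_right (m := ∞) (by simp)).comp (by fun_prop)).clm_apply contDiff_const
  have key : ∀ t w, F (t, w) = t * ∫ s in (0 : ℝ)..1, fderiv ℝ F (s * t, w) (1, 0) := by
    intro t w
    have hd : ∀ s ∈ Set.uIcc (0 : ℝ) 1, HasDerivAt (fun s : ℝ => F (s * t, w))
        (t * fderiv ℝ F (s * t, w) (1, 0)) s := by
      intro s _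
      have h1 : HasDerivAt (fun s : ℝ => (s * t, w)) (t, (0 : E)) s := by
        simpa using ((hasDerivAt_id s).mul_const t).prodMk (hasDerivAt_const s w)
      have h2 := ((hF.differentiable (by simp)) (s * t, w)).hasFDerivAt.comp_hasDerivAt s h1
      have h3 : ((t, 0) : ℝ × E) = t • (1, 0) := by simp
      rwa [h3, map_smul, smul_eq_mul] at h2
    have hc : Continuous fun s : ℝ => fderiv ℝ F (s * t, w) (1, 0) :=
      hG.continuous.comp (f := fun s : ℝ => ((t, w), s)) (by fun_prop)
    have := intervalIntegral.integral_eq_sub_of_hasDerivAt hd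
      ((continuous_const.mul hc).intervalIntegrable 0 1)
    rw [intervalIntegral.integral_const_mul] at this
    simpa [hF0] using this.symm
  refine ⟨fun p => ∫ s in (0 : ℝ)..1, fderiv ℝ F (s * p.1, p.2) (1, 0),
    hG.intervalIntegral_snd, fun t w => ?_, key⟩
  rcases eq_or_ne t 0 with rfl | ht
  · simp
  · have h1 := key t w
    have h2 := key (-t) w
    rw [hodd, h1] at h2
    exact mul_left_cancel₀ ht (by linarith)

section Radius

variable {n : ℕ}

theorem rad_eq_norm (w : Fin n → ℝ) :
    rad w = ‖(EuclideanSpace.equiv (Fin n) ℝ).symm w‖ := by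
  simp [rad, EuclideanSpace.norm_eq]

theorem continuous_rad : Continuous (rad : (Fin n → ℝ) → ℝ) := by
  unfold rad
  fun_prop

theorem rad_zero : rad (0 : Fin n → ℝ) = 0 := by simp [rad]

theorem rad_pos {w : Fin n → ℝ} (hw : w ≠ 0) : 0 < rad w := by
  rw [rad_eq_norm, norm_pos_iff]
  simpa using hw

theorem rad_smul {c : ℝ} (hc : 0 < c) (w : Fin n → ℝ) : rad (c • w) = c * rad w := by
  rw [rad_eq_norm, rad_eq_norm, map_smul, norm_smul, Real.norm_of_nonneg hc.le]

theorem isBigO_rad_prodMk :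
    (fun w : Fin n → ℝ => (rad w, w)) =O[𝓝 0] fun w => w := by
  have h : (rad : (Fin n → ℝ) → ℝ) =O[𝓝 0] fun w => w := by
    rw [funext rad_eq_norm]
    exact (ContinuousLinearMap.isBigO_id
      (EuclideanSpace.equiv (Fin n) ℝ).symm.toContinuousLinearMap _).norm_left
  exact h.prod_left (isBigO_refl _ _)

theorem tendsto_rad_prodMk :
    Tendsto (fun w : Fin n → ℝ => (rad w, w)) (𝓝 0) (𝓝 0) := by
  have : Continuous fun w : Fin n → ℝ => (rad w, w) := continuous_rad.prodMk continuous_id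
  simpa only [rad_zero, Prod.mk_zero_zero] using this.tendsto 0

/-- The Euclidean pairing with `w`, as a linear form. -/
noncomputable def dotCLM (w : Fin n → ℝ) : (Fin n → ℝ) →L[ℝ] ℝ :=
  ∑ i, w i • ContinuousLinearMap.proj i

theorem dotCLM_apply (w y : Fin n → ℝ) : dotCLM w y = ∑ i, w i * y i := by
  simp [dotCLM]

theorem contDiff_dotCLM_apply (y : Fin n → ℝ) {m : WithTop ℕ∞} :
    ContDiff ℝ m fun w : Fin n → ℝ => dotCLM w y := by
  simp_rw [dotCLM_apply]
  fun_prop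

theorem hasFDerivAt_rad {w : Fin n → ℝ} (hw : w ≠ 0) :
    HasFDerivAt rad ((rad w)⁻¹ • dotCLM w) w := by
  have h1 : HasFDerivAt (fun v : Fin n → ℝ => ∑ i, v i ^ 2) ((2 : ℝ) • dotCLM w) w := by
    have : ∀ i ∈ (univ : Finset (Fin n)), HasFDerivAt (fun v : Fin n → ℝ => v i ^ 2)
        ((2 * w i) • ContinuousLinearMap.proj (R := ℝ) (φ := fun _ : Fin n => ℝ) i) w := by
      intro i _
      simpa using (hasFDerivAt_apply (𝕜 := ℝ) (F' := fun _ : Fin n => ℝ) i w).pow 2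
    convert! HasFDerivAt.fun_sum this using 1
    simp [dotCLM, Finset.smul_sum, smul_smul]
  have hne : ∑ i, w i ^ 2 ≠ 0 := fun h => (rad_pos hw).ne' (by simp [rad, h])
  have h2 := h1.sqrt hne
  convert! h2 using 1
  rw [smul_smul]
  congr 1
  have := (rad_pos hw).ne'
  change (rad w)⁻¹ = 1 / (2 * rad w) * 2
  field_simp

theorem contDiffAt_rad {w : Fin n → ℝ} (hw : w ≠ 0) {m : WithTop ℕ∞} : ContDiffAt ℝ m rad w := by
  have hne : ∑ i, w i ^ 2 ≠ 0 := fun h => (rad_pos hw).ne' (by simp [rad, h])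
  unfold rad
  exact ContDiffAt.sqrt (by fun_prop) hne

/-- The derivative of the pullback of `f` to the light cone, away from the vertex. -/
theorem hasFDerivAt_comp_rad {f : ℝ × (Fin n → ℝ) → ℝ} {w : Fin n → ℝ}
    (hf : DifferentiableAt ℝ f (rad w, w)) (hw : w ≠ 0) :
    HasFDerivAt (fun w => f (rad w, w)) ((fderiv ℝ f (rad w, w)).comp
      (((rad w)⁻¹ • dotCLM w).prod (ContinuousLinearMap.id ℝ _))) w :=
  hf.hasFDerivAt.comp (f := fun w => (rad w, w)) w ((hasFDerivAt_rad hw).prodMk (hasFDerivAt_id w))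

theorem map_prodMk_eq (L : ℝ × (Fin n → ℝ) →L[ℝ] ℝ) (a : ℝ) (y : Fin n → ℝ) :
    L (a, y) = a * L (1, 0) + L (0, y) := by
  have : ((a, y) : ℝ × (Fin n → ℝ)) = a • (1, 0) + (0, y) := by simp
  rw [this, map_add, map_smul, smul_eq_mul]

theorem hasFDerivAt_comp_rad_of_even {F H : ℝ × (Fin n → ℝ) → ℝ} (hF : ContDiff ℝ 1 F)
    (hH : ∀ t w, fderiv ℝ F (t, w) (1, 0) = t * H (t, w)) (w : Fin n → ℝ) :
    HasFDerivAt (fun w => F (rad w, w)) (H (rad w, w) • dotCLM w +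
      (fderiv ℝ F (rad w, w)).comp (ContinuousLinearMap.inr ℝ ℝ (Fin n → ℝ))) w := by
  have hd := hF.differentiable one_ne_zero
  rcases eq_or_ne w 0 with rfl | hw
  · have h0 := (hd (0, 0)).hasFDerivAt.isLittleO
    have h1 := (h0.comp_tendsto (k := fun w : Fin n → ℝ => (rad w, w))
      tendsto_rad_prodMk).trans_isBigO (k := fun w : Fin n → ℝ => w)
        (by simpa [Function.comp_def] using isBigO_rad_prodMk)
    refine HasFDerivAt.of_isLittleO ?_
    refine (h1.congr_left fun y => ?_).congr_right fun y => (sub_zero y).symm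
    have := hH 0 0
    rw [zero_mul] at this
    simp only [Function.comp_apply, rad_zero, Prod.mk_sub_mk, sub_zero, dotCLM,
      add_apply, ContinuousLinearMap.comp_apply, ContinuousLinearMap.inr_apply]
    rw [map_prodMk_eq, this]
    simp
  · convert! hasFDerivAt_comp_rad (hd _) hw using 1
    ext1 y
    have := (rad_pos hw).ne'
    simp only [add_apply, smul_apply, smul_eq_mul,
      ContinuousLinearMap.comp_apply, ContinuousLinearMap.inr_apply,
      ContinuousLinearMap.prod_apply, ContinuousLinearMap.id_apply]
    rw [map_prodMk_eq _ ((rad w)⁻¹ * _), hH]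
    field_simp

theorem fderiv_fst_neg_of_even {F : ℝ × (Fin n → ℝ) → ℝ} (hF : Differentiable ℝ F)
    (heven : ∀ t w, F (-t, w) = F (t, w)) (t : ℝ) (w v : Fin n → ℝ) (a : ℝ) :
    fderiv ℝ F (-t, w) (a, v) = fderiv ℝ F (t, w) (-a, v) := by
  let σ : ℝ × (Fin n → ℝ) →L[ℝ] ℝ × (Fin n → ℝ) :=
    (-ContinuousLinearMap.fst ℝ ℝ (Fin n → ℝ)).prod (ContinuousLinearMap.snd ℝ ℝ (Fin n → ℝ))
  have hcomp : F = F ∘ σ := by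
    ext ⟨t, w⟩
    exact (heven t w).symm
  have h := (hF (σ (-t, w))).hasFDerivAt.comp (-t, w) σ.hasFDerivAt
  rw [← hcomp] at h
  rw [h.fderiv]
  simp [σ]

theorem contDiff_comp_rad_of_even {F : ℝ × (Fin n → ℝ) → ℝ} (hF : ContDiff ℝ ∞ F)
    (heven : ∀ t w, F (-t, w) = F (t, w)) : ContDiff ℝ ∞ fun w => F (rad w, w) := by
  refine contDiff_infty.2 fun m => ?_
  induction m generalizing F with
  | zero =>
    exact contDiff_zero.2 (hF.continuous.comp (continuous_rad.prodMk continuous_id))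
  | succ m ih =>
    have h1 : ContDiff ℝ 1 F := hF.of_le (by exact_mod_cast le_top)
    have hd := h1.differentiable one_ne_zero
    have hpartial : ∀ v, ContDiff ℝ ∞ fun p => fderiv ℝ F p v := fun v =>
      (hF.fderiv_right (m := ∞) (by simp)).clm_apply contDiff_const
    obtain ⟨H, hH, hHeven, hFH⟩ := exists_even_eq_mul_of_odd (hpartial (1, 0)) fun t w => by
      rw [fderiv_fst_neg_of_even hd heven, ← map_neg]
      simp
    have hder := hasFDerivAt_comp_rad_of_even h1 hFH
    push_cast
    refine contDiff_succ_iff_fderiv_apply.2 ⟨fun w => (hder w).differentiableAt, by simp, ?_⟩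
    intro y
    have hsum : ContDiff ℝ m fun w => H (rad w, w) * dotCLM w y + fderiv ℝ F (rad w, w) (0, y) :=
      ((ih hH hHeven).mul (contDiff_dotCLM_apply y)).add (ih (hpartial (0, y)) fun t w => by
        rw [fderiv_fst_neg_of_even hd heven, neg_zero])
    convert! hsum using 2 with w
    rw [(hder w).fderiv]
    simp

theorem exists_contDiff_decomposition_of_contDiff_infty {f : ℝ × (Fin n → ℝ) → ℝ}
    (hf : ContDiff ℝ ∞ f) :
    ∃ a b : (Fin n → ℝ) → ℝ, ContDiff ℝ ∞ a ∧ ContDiff ℝ ∞ b ∧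
      ∀ w, f (rad w, w) = a w + rad w * b w := by
  have hneg : ContDiff ℝ ∞ fun p : ℝ × (Fin n → ℝ) => f (-p.1, p.2) := hf.comp (by fun_prop)
  obtain ⟨H, hH, hHeven, hfH⟩ := exists_even_eq_mul_of_odd
    (F := fun p => (f p - f (-p.1, p.2)) / 2) ((hf.sub hneg).div_const 2)
    fun t w => by simp only [neg_neg]; ring
  refine ⟨_, _, contDiff_comp_rad_of_even (F := fun p => (f p + f (-p.1, p.2)) / 2)
    ((hf.add hneg).div_const 2) (fun t w => by simp only [neg_neg]; ring),
    contDiff_comp_rad_of_even hH hHeven, fun w => ?_⟩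
  rw [← hfH]
  ring

end Radius

section Taylor

variable {E F : Type*} [NormedAddCommGroup E] [NormedSpace ℝ E]
  [NormedAddCommGroup F] [NormedSpace ℝ F]

theorem fderiv_iteratedFDeriv_apply {f : E → F} {i : ℕ} (hf : ContDiff ℝ (i + 1) f) (x u : E)
    (v : Fin i → E) :
    fderiv ℝ (fun y => iteratedFDeriv ℝ i f y v) x u =
      iteratedFDeriv ℝ (i + 1) f x (Fin.cons u v) := by
  have hd : DifferentiableAt ℝ (iteratedFDeriv ℝ i f) x :=
    hf.differentiable_iteratedFDeriv (by exact_mod_cast Nat.lt_succ_self i) x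
  rw [iteratedFDeriv_succ_apply_left, Fin.cons_zero, Fin.tail_cons,
    fderiv_continuousMultilinear_apply_const_apply hd]

theorem iteratedFDeriv_cons_cons_comm {f : E → F} {i : ℕ} (hf : ContDiff ℝ (i + 2 : ℕ) f)
    (x a b : E) (v : Fin i → E) :
    iteratedFDeriv ℝ (i + 2) f x (Fin.cons a (Fin.cons b v)) =
      iteratedFDeriv ℝ (i + 2) f x (Fin.cons b (Fin.cons a v)) := by
  set g : E → F := fun y => iteratedFDeriv ℝ i f y v
  have hgC : ContDiff ℝ 2 g := by
    have h1 : ContDiff ℝ 2 (iteratedFDeriv ℝ i f) :=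
      hf.iteratedFDeriv_right (by push_cast; rw [add_comm])
    exact (ContinuousMultilinearMap.apply ℝ (fun _ : Fin i => E) F v).contDiff.comp h1
  have hg1 : ∀ y c, fderiv ℝ g y c = iteratedFDeriv ℝ (i + 1) f y (Fin.cons c v) := fun y c =>
    fderiv_iteratedFDeriv_apply (hf.of_le (by exact_mod_cast Nat.le_succ _)) y c v
  have hg2 : ∀ c d, fderiv ℝ (fderiv ℝ g) x d c =
      iteratedFDeriv ℝ (i + 2) f x (Fin.cons d (Fin.cons c v)) := fun c d => by
    rw [← fderiv_iteratedFDeriv_apply (i := i + 1) (by exact_mod_cast hf), ← funext (hg1 · c),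
      fderiv_clm_apply ((hgC.fderiv_right (m := 1) (by norm_num)).differentiable one_ne_zero x)
        (differentiableAt_const c)]
    simp
  rw [← hg2, ← hg2]
  exact (hgC.contDiffAt.isSymmSndFDerivAt (by simp)).eq a b

theorem iteratedFDeriv_comp_swap_succ {f : E → F} {i : ℕ} (hf : ContDiff ℝ (i + 1 : ℕ) f) (x : E)
    (v : Fin (i + 1) → E) (j : Fin i) :
    iteratedFDeriv ℝ (i + 1) f x (v ∘ Equiv.swap j.castSucc j.succ) =
      iteratedFDeriv ℝ (i + 1) f x v := by
  induction i generalizing x with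
  | zero => exact j.elim0
  | succ i ih =>
    cases j using Fin.cases with
    | zero =>
      have h1 : v = Fin.cons (v 0) (Fin.cons (v 1) fun l => v l.succ.succ) := by
        ext l
        refine Fin.cases rfl (fun l => ?_) l
        exact Fin.cases rfl (fun l => rfl) l
      have h2 : v ∘ Equiv.swap (Fin.castSucc 0) (Fin.succ 0) =
          Fin.cons (v 1) (Fin.cons (v 0) fun l => v l.succ.succ) := by
        ext l
        refine Fin.cases (by simp) (fun l => ?_) l
        refine Fin.cases (by simp) (fun l => ?_) l
        have h0 : l.succ.succ ≠ 0 := Fin.succ_ne_zero _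
        have h1 : l.succ.succ ≠ 1 := fun h => Fin.succ_ne_zero l (Fin.succ_injective _ h)
        simp [Equiv.swap_apply_of_ne_of_ne h0 h1]
      rw [h2, iteratedFDeriv_cons_cons_comm hf, ← h1]
    | succ j =>
      have hf' : ContDiff ℝ (i + 1 : ℕ) f := hf.of_le (by exact_mod_cast Nat.le_succ _)
      have h2 : v ∘ Equiv.swap j.succ.castSucc j.succ.succ =
          Fin.cons (v 0) (Fin.tail v ∘ Equiv.swap j.castSucc j.succ) := by
        ext l
        refine Fin.cases ?_ (fun l => ?_) l
        · have h0 : (0 : Fin (i + 2)) ≠ j.succ.castSucc := by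
            rw [Fin.castSucc_succ]; exact (Fin.succ_ne_zero _).symm
          rw [Function.comp_apply, Equiv.swap_apply_of_ne_of_ne h0 (Fin.succ_ne_zero _).symm,
            Fin.cons_zero]
        · simp only [Function.comp_apply, Fin.cons_succ, Fin.tail, Fin.castSucc_succ]
          rw [(Fin.succ_injective _).map_swap]
      conv_rhs => rw [← Fin.cons_self_tail v]
      rw [h2, ← fderiv_iteratedFDeriv_apply (by exact_mod_cast hf),
        ← fderiv_iteratedFDeriv_apply (by exact_mod_cast hf),
        funext fun y => ih hf' y (Fin.tail v) j]

/-- The iterated derivative of a `C^i` function is symmetric. -/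
theorem iteratedFDeriv_comp_perm_of_contDiff {f : E → F} {i : ℕ} (hf : ContDiff ℝ i f) (x : E)
    (v : Fin i → E) (σ : Equiv.Perm (Fin i)) :
    iteratedFDeriv ℝ i f x (v ∘ σ) = iteratedFDeriv ℝ i f x v := by
  cases i with
  | zero => rw [Subsingleton.elim (v ∘ σ) v]
  | succ i =>
    have hσ : σ ∈ Submonoid.closure
        (Set.range fun j : Fin i => Equiv.swap j.castSucc j.succ) := by
      rw [Equiv.Perm.mclosure_swap_castSucc_succ]
      trivial
    induction hσ using Submonoid.closure_induction generalizing v with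
    | mem τ hτ =>
      obtain ⟨j, rfl⟩ := hτ
      exact iteratedFDeriv_comp_swap_succ hf x v j
    | one => rfl
    | mul τ ρ _ _ hτ hρ =>
      rw [Equiv.Perm.coe_mul, ← Function.comp_assoc, hρ, hτ]

/-- A `C^k` function has the same derivatives up to order `k` at the origin as a smooth one. -/
theorem exists_contDiff_iteratedFDeriv_eq {f : E → ℝ} {k : ℕ} (hf : ContDiff ℝ k f) :
    ∃ P : E → ℝ, ContDiff ℝ ∞ P ∧ ∀ i ≤ k, iteratedFDeriv ℝ i P 0 = iteratedFDeriv ℝ i f 0 := by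
  let p : FormalMultilinearSeries ℝ E ℝ := fun i =>
    if i ≤ k then ((i.factorial : ℝ)⁻¹) • iteratedFDeriv ℝ i f 0 else 0
  have hp : ∀ m, k + 1 ≤ m → p m = 0 := fun m hm => if_neg (by lia)
  have hP := p.hasFiniteFPowerSeriesOnBall_of_finite hp
  refine ⟨p.sum, ?_, fun i hi => ?_⟩
  · refine contDiff_iff_contDiffAt.2 fun x => CPolynomialAt.contDiffAt (𝕜 := ℝ) ?_
    exact hP.cpolynomialAt_of_mem (by simp)
  · ext v
    rw [hP.toHasFPowerSeriesOnBall.iteratedFDeriv_eq_sum_of_completeSpace]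
    have hsym := iteratedFDeriv_comp_perm_of_contDiff
      (hf.of_le (by exact_mod_cast hi : (i : WithTop ℕ∞) ≤ k)) 0 v
    have hfac : (i.factorial : ℝ) ≠ 0 := by positivity
    simp only [Function.comp_def] at hsym
    simp [p, hi, hsym, Fintype.card_perm, hfac]

/-- `f` is of class `C^k`, with all derivatives up to order `k` vanishing at the origin. -/
def IsFlatAtZero (k : ℕ) (f : E → F) : Prop :=
  ContDiff ℝ k f ∧ ∀ i ≤ k, iteratedFDeriv ℝ i f 0 = 0

theorem IsFlatAtZero.apply_zero {f : E → F} {k : ℕ} (hf : IsFlatAtZero k f) : f 0 = 0 := by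
  simpa using congrArg (fun L => L 0) (hf.2 0 (Nat.zero_le k))

theorem IsFlatAtZero.fderiv_right {f : E → F} {k : ℕ} (hf : IsFlatAtZero (k + 1) f) :
    IsFlatAtZero k (fderiv ℝ f) := by
  refine ⟨ContDiff.fderiv_right hf.1 (by simp), fun i hi => ?_⟩
  rw [← norm_eq_zero, norm_iteratedFDeriv_fderiv, hf.2 _ (by lia), norm_zero]

theorem IsFlatAtZero.fderiv_apply {f : E → F} {k : ℕ} (hf : IsFlatAtZero (k + 1) f) (u : E) :
    IsFlatAtZero k (fun x => fderiv ℝ f x u) := by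
  refine ⟨hf.fderiv_right.1.clm_apply contDiff_const, fun i hi => ?_⟩
  have := norm_iteratedFDeriv_clm_apply_const (c := u) (x := 0) hf.fderiv_right.1.contDiffAt
    (by exact_mod_cast hi : (i : WithTop ℕ∞) ≤ k)
  rw [hf.fderiv_right.2 i hi, norm_zero, mul_zero] at this
  exact norm_le_zero_iff.1 this

theorem isLittleO_pow_succ_of_fderiv {f : E → F} {k : ℕ} (hf : Differentiable ℝ f) (h0 : f 0 = 0)
    (h : fderiv ℝ f =o[𝓝 0] fun x => ‖x‖ ^ k) : f =o[𝓝 0] fun x => ‖x‖ ^ (k + 1) := by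
  refine isLittleO_iff.2 fun ε hε => ?_
  obtain ⟨δ, hδ, hball⟩ := Metric.eventually_nhds_iff_ball.1 (isLittleO_iff.1 h hε)
  filter_upwards [Metric.ball_mem_nhds 0 hδ] with x hx
  have hbound : ∀ z ∈ Metric.closedBall (0 : E) ‖x‖, ‖fderiv ℝ f z‖ ≤ ε * ‖x‖ ^ k := by
    intro z hz
    rw [mem_closedBall_zero_iff] at hz
    refine (hball z (mem_ball_zero_iff.2 (hz.trans_lt (mem_ball_zero_iff.1 hx)))).trans ?_
    rw [norm_pow, norm_norm]
    gcongr
  have := (convex_closedBall (0 : E) ‖x‖).norm_image_sub_le_of_norm_fderiv_le (𝕜 := ℝ)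
    (fun z _ => hf z) hbound (Metric.mem_closedBall_self (norm_nonneg x))
    (mem_closedBall_zero_iff.2 le_rfl)
  rw [h0, sub_zero, sub_zero] at this
  rw [norm_pow, norm_norm, pow_succ, ← mul_assoc]
  exact this

end Taylor

universe u

theorem IsFlatAtZero.isLittleO {E F : Type u} [NormedAddCommGroup E] [NormedSpace ℝ E]
    [NormedAddCommGroup F] [NormedSpace ℝ F] {f : E → F} {k : ℕ} (hf : IsFlatAtZero k f) :
    f =o[𝓝 0] fun x => ‖x‖ ^ k := by
  induction k generalizing F with
  | zero =>
    simp only [pow_zero]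
    rw [isLittleO_one_iff]
    simpa [hf.apply_zero] using hf.1.continuous.tendsto 0
  | succ k ih =>
    exact isLittleO_pow_succ_of_fderiv (hf.1.differentiable (by simp)) hf.apply_zero
      (ih hf.fderiv_right)

section Homogeneous

variable {E : Type*} [NormedAddCommGroup E] [NormedSpace ℝ E]

/-- `h` is smooth and homogeneous of degree `-j` away from the origin. -/
def IsNegHomogeneous (j : ℕ) (h : E → ℝ) : Prop :=
  (∀ w ≠ 0, ContDiffAt ℝ ∞ h w) ∧ ∀ c : ℝ, 0 < c → ∀ w ≠ 0, c ^ j * h (c • w) = h w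

theorem IsNegHomogeneous.mul {i j : ℕ} {a b : E → ℝ} (ha : IsNegHomogeneous i a)
    (hb : IsNegHomogeneous j b) : IsNegHomogeneous (i + j) fun w => a w * b w := by
  refine ⟨fun w hw => (ha.1 w hw).mul (hb.1 w hw), fun c hc w hw => ?_⟩
  beta_reduce
  rw [← ha.2 c hc w hw, ← hb.2 c hc w hw]
  ring

theorem IsNegHomogeneous.fderiv_apply {j : ℕ} {h : E → ℝ} (hh : IsNegHomogeneous j h) (y : E) :
    IsNegHomogeneous (j + 1) fun w => fderiv ℝ h w y := by
  refine ⟨fun w hw => ((hh.1 w hw).fderiv_right (by simp)).clm_apply contDiffAt_const,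
    fun c hc w hw => ?_⟩
  have hcw : c • w ≠ 0 := smul_ne_zero hc.ne' hw
  have h1 : HasFDerivAt (fun w => c ^ j * h (c • w))
      (c ^ j • (fderiv ℝ h (c • w)).comp (c • ContinuousLinearMap.id ℝ E)) w :=
    (((hh.1 _ hcw).differentiableAt (by simp)).hasFDerivAt.comp w
      ((hasFDerivAt_id w).const_smul c)).const_mul (c ^ j)
  have h2 : (fun w => c ^ j * h (c • w)) =ᶠ[𝓝 w] h :=
    (eventually_ne_nhds hw).mono fun v hv => hh.2 c hc v hv
  beta_reduce
  rw [← h2.fderiv_eq, h1.fderiv]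
  simp
  ring

theorem IsNegHomogeneous.exists_bound [ProperSpace E] {j : ℕ} {h : E → ℝ}
    (hh : IsNegHomogeneous j h) : ∃ C, ∀ w ≠ 0, ‖w‖ ^ j * ‖h w‖ ≤ C := by
  have hc : ContinuousOn h (Metric.sphere 0 1) := fun w hw =>
    (hh.1 w (ne_zero_of_mem_unit_sphere ⟨w, hw⟩)).continuousAt.continuousWithinAt
  obtain ⟨C, hC⟩ := (isCompact_sphere (0 : E) 1).exists_bound_of_continuousOn hc
  refine ⟨C, fun w hw => ?_⟩
  have hw' := norm_pos_iff.2 hw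
  have h1 := hh.2 ‖w‖⁻¹ (inv_pos.2 hw') w hw
  have h2 : ‖w‖⁻¹ • w ∈ Metric.sphere (0 : E) 1 := by
    rw [mem_sphere_zero_iff_norm, norm_smul, norm_inv, norm_norm, inv_mul_cancel₀ hw'.ne']
  rw [← h1, norm_mul, norm_pow, norm_inv, norm_norm, ← mul_assoc, ← mul_pow,
    mul_inv_cancel₀ hw'.ne', one_pow, one_mul]
  exact hC _ h2

end Homogeneous

section Cone

variable {n : ℕ}

theorem isNegHomogeneous_dotCLM_div_rad (y : Fin n → ℝ) :
    IsNegHomogeneous 0 fun w => (rad w)⁻¹ * dotCLM w y := by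
  refine ⟨fun w hw => ((contDiffAt_rad hw).inv (rad_pos hw).ne').mul
    (contDiff_dotCLM_apply y).contDiffAt, fun c hc w hw => ?_⟩
  have h1 := (rad_pos hw).ne'
  have h2 : dotCLM (c • w) y = c * dotCLM w y := by
    simp [dotCLM_apply, Finset.mul_sum, mul_assoc]
  beta_reduce
  rw [rad_smul hc, h2]
  field_simp

theorem IsFlatAtZero.isLittleO_mul_comp_rad {d j : ℕ} {h : (Fin n → ℝ) → ℝ}
    {R : ℝ × (Fin n → ℝ) → ℝ} (hh : IsNegHomogeneous j h) (hR : IsFlatAtZero (d + j) R) :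
    (fun w => h w * R (rad w, w)) =o[𝓝 0] fun w => ‖w‖ ^ d := by
  obtain ⟨C, hC⟩ := hh.exists_bound
  have h1 : (fun w : Fin n → ℝ => R (rad w, w)) =o[𝓝 0] fun w => ‖w‖ ^ (d + j) :=
    (hR.isLittleO.comp_tendsto tendsto_rad_prodMk).trans_isBigO (isBigO_rad_prodMk.norm_norm.pow _)
  have h2 : (fun w : Fin n → ℝ => h w * R (rad w, w)) =O[𝓝 0]
      fun w => (‖w‖ ^ j)⁻¹ * R (rad w, w) := by
    refine IsBigO.of_bound C (Eventually.of_forall fun w => ?_)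
    rcases eq_or_ne w 0 with rfl | hw
    · simp [rad_zero, show R (0, 0) = 0 from hR.apply_zero]
    · have hw' := norm_pos_iff.2 hw
      rw [norm_mul, norm_mul, ← mul_assoc, norm_inv, norm_pow, norm_norm, ← div_eq_mul_inv]
      gcongr
      rw [le_div_iff₀ (by positivity), mul_comm]
      exact hC w hw
  have h3 : (fun w : Fin n → ℝ => (‖w‖ ^ j)⁻¹ * ‖w‖ ^ (d + j)) =O[𝓝 0] fun w => ‖w‖ ^ d := by
    refine IsBigO.of_bound 1 (Eventually.of_forall fun w => ?_)
    rw [pow_add, one_mul, norm_mul, norm_mul, norm_inv, mul_comm, mul_assoc]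
    exact mul_le_of_le_one_right (norm_nonneg _) mul_inv_le_one
  exact h2.trans_isLittleO (((isBigO_refl _ _).mul_isLittleO h1).trans_isBigO h3)

theorem IsFlatAtZero.hasFDerivAt_mul_comp_rad {d j : ℕ} {h : (Fin n → ℝ) → ℝ}
    {R : ℝ × (Fin n → ℝ) → ℝ} (hh : IsNegHomogeneous j h) (hR : IsFlatAtZero (d + 1 + j) R)
    (w : Fin n → ℝ) :
    HasFDerivAt (fun w => h w * R (rad w, w))
      (h w • (fderiv ℝ R (rad w, w)).comp
        (((rad w)⁻¹ • dotCLM w).prod (ContinuousLinearMap.id ℝ _)) +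
        R (rad w, w) • fderiv ℝ h w) w := by
  rcases eq_or_ne w 0 with rfl | hw
  · have hR' : IsFlatAtZero (d + j + 1) R := by rwa [add_right_comm] at hR
    have h0 : R (0, 0) = 0 := hR.apply_zero
    have h1 : fderiv ℝ R (0, 0) = 0 := hR'.fderiv_right.apply_zero
    refine HasFDerivAt.of_isLittleO ?_
    have h2 : (fun w : Fin n → ℝ => ‖w‖ ^ (d + 1)) =O[𝓝 0] fun w => w := by
      refine IsBigO.of_bound 1 ?_
      filter_upwards [Metric.ball_mem_nhds (0 : Fin n → ℝ) one_pos] with w hw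
      rw [mem_ball_zero_iff] at hw
      rw [norm_pow, norm_norm, one_mul]
      exact pow_le_of_le_one (norm_nonneg w) hw.le (Nat.succ_ne_zero d)
    simpa [rad_zero, h0, h1] using (hR.isLittleO_mul_comp_rad hh).trans_isBigO h2
  · have hd : Differentiable ℝ R := hR.1.differentiable (by
      have : d + 1 + j ≠ 0 := by lia
      exact_mod_cast this)
    exact ((hh.1 w hw).differentiableAt (by simp)).hasFDerivAt.mul
      (hasFDerivAt_comp_rad (hd _) hw)

theorem IsFlatAtZero.contDiff_mul_comp_rad {d j : ℕ} {h : (Fin n → ℝ) → ℝ}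
    {R : ℝ × (Fin n → ℝ) → ℝ} (hh : IsNegHomogeneous j h) (hR : IsFlatAtZero (d + j) R) :
    ContDiff ℝ d fun w => h w * R (rad w, w) := by
  induction d generalizing j h R with
  | zero =>
    refine contDiff_zero.2 (continuous_iff_continuousAt.2 fun w => ?_)
    rcases eq_or_ne w 0 with rfl | hw
    · have h0 : R (0, 0) = 0 := hR.apply_zero
      have := hR.isLittleO_mul_comp_rad hh
      simp only [pow_zero, isLittleO_one_iff] at this
      simpa [ContinuousAt, rad_zero, h0] using this
    · exact (hh.1 w hw).continuousAt.mul
        (hR.1.continuous.comp (continuous_rad.prodMk continuous_id)).continuousAt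
  | succ d ih =>
    have hder := hR.hasFDerivAt_mul_comp_rad hh
    have hR' : IsFlatAtZero (d + j + 1) R := by rwa [add_right_comm] at hR
    push_cast
    refine contDiff_succ_iff_fderiv_apply.2 ⟨fun w => (hder w).differentiableAt, by simp, ?_⟩
    intro y
    have h1 := ih (hh.mul (isNegHomogeneous_dotCLM_div_rad y)) (hR'.fderiv_apply (1, 0))
    have h2 := ih hh (hR'.fderiv_apply (0, y))
    have h3 := ih (hh.fderiv_apply y) (R := R) (by rwa [add_assoc, add_comm 1] at hR)
    convert! (h1.add h2).add h3 using 2 with w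
    rw [(hder w).fderiv]
    simp only [add_apply, smul_apply, smul_eq_mul, ContinuousLinearMap.comp_apply,
      ContinuousLinearMap.prod_apply, ContinuousLinearMap.id_apply]
    rw [map_prodMk_eq _ ((rad w)⁻¹ * _)]
    ring

theorem IsFlatAtZero.contDiff_comp_rad {k : ℕ} {R : ℝ × (Fin n → ℝ) → ℝ}
    (hR : IsFlatAtZero k R) : ContDiff ℝ k fun w => R (rad w, w) := by
  have h1 : IsNegHomogeneous 0 fun _ : Fin n → ℝ => (1 : ℝ) :=
    ⟨fun _ _ => contDiffAt_const, fun _ _ _ _ => by simp⟩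
  simpa using hR.contDiff_mul_comp_rad (d := k) h1

theorem exists_contDiff_decomposition {k : ℕ∞} {f : ℝ × (Fin n → ℝ) → ℝ}
    (hf : ContDiff ℝ k f) :
    ∃ a b : (Fin n → ℝ) → ℝ, ContDiff ℝ k a ∧ ContDiff ℝ k b ∧
      ∀ w, f (rad w, w) = a w + rad w * b w := by
  induction k using ENat.recTopCoe with
  | top => exact exists_contDiff_decomposition_of_contDiff_infty hf
  | coe k =>
    obtain ⟨P, hP, hPf⟩ := exists_contDiff_iteratedFDeriv_eq hf
    obtain ⟨a, b, ha, hb, hab⟩ := exists_contDiff_decomposition_of_contDiff_infty hP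
    have hle : ((k : ℕ∞) : WithTop ℕ∞) ≤ ∞ := by exact_mod_cast le_top
    have hR : IsFlatAtZero k (f - P) := by
      refine ⟨hf.sub (hP.of_le hle), fun i hi => ?_⟩
      have hi' : (i : WithTop ℕ∞) ≤ k := by exact_mod_cast hi
      rw [iteratedFDeriv_sub_apply (hf.of_le hi').contDiffAt
        ((hP.of_le hle).of_le hi').contDiffAt, hPf i hi, sub_self]
    refine ⟨_, b, (ha.of_le hle).add hR.contDiff_comp_rad, hb.of_le hle, fun w => ?_⟩
    rw [Pi.sub_apply, hab]
    ring

end Cone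

/-- A function `φ` on the light cone `{w⁰ = |⃗w|}` (parameterized by `⃗w ∈ ℝⁿ`) extends to a
`C^k` (resp. smooth, for `k = ⊤`) function on ℝⁿ⁺¹ iff `φ = φ̂ + r φ̌` with `φ̂, φ̌` of class
`C^k` (resp. smooth) on ℝⁿ. -/
theorem stmt10 (n : ℕ) (k : ℕ∞) (φ : (Fin n → ℝ) → ℝ) :
    (∃ f : (Fin (n+1) → ℝ) → ℝ, ContDiff ℝ k f ∧
        ∀ v : Fin n → ℝ, φ v = f (Fin.cons (rad v) v)) ↔
    (∃ φh φc : (Fin n → ℝ) → ℝ, ContDiff ℝ k φh ∧ ContDiff ℝ k φc ∧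
        ∀ v : Fin n → ℝ, φ v = φh v + rad v * φc v) := by
  constructor
  · rintro ⟨f, hf, hφ⟩
    have hcons : ContDiff ℝ k fun p : ℝ × (Fin n → ℝ) =>
        (Fin.cons p.1 p.2 : Fin (n + 1) → ℝ) := by
      refine contDiff_pi.2 fun i => ?_
      refine Fin.cases ?_ (fun i => ?_) i
      · exact contDiff_fst
      · exact (contDiff_apply ℝ ℝ i).comp contDiff_snd
    obtain ⟨a, b, ha, hb, hab⟩ := exists_contDiff_decomposition (hf.comp hcons)
    exact ⟨a, b, ha, hb, fun v => (hφ v).trans (hab v)⟩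
  · rintro ⟨a, b, ha, hb, hφ⟩
    have htail : ContDiff ℝ k fun x : Fin (n + 1) → ℝ => Fin.tail x :=
      contDiff_pi.2 fun i => contDiff_apply ℝ ℝ i.succ
    refine ⟨fun x => a (Fin.tail x) + x 0 * b (Fin.tail x),
      (ha.comp htail).add ((contDiff_apply ℝ ℝ 0).mul (hb.comp htail)), fun v => ?_⟩
    simp [hφ]
end
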